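/- Let u be a ground state, or a solution of the IVP that changes sign with exactly k zeros z₁ < ⋯ < z_k. Then the four functions E(r), P(r), P₁(r), P₂(r) are strictly positive: for all r > 0 if u is decaying, and for all r ∈ (0, z_k] if u is not decaying. -/

import Mathlib

open Real Filter Set

/-- The nonlinearity `f(s) = -s + |s|^(p-1) s`. -/
noncomputable def f (p s : ℝ) : ℝ := -s + |s| ^ (p - 1) * s

/-- The derivative of the nonlinearity, `f'(s) = -1 + p |s|^(p-1)`. -/
noncomputable def fder (p s : ℝ) : ℝ := -1 + p * |s| ^ (p - 1)

/-- The primitive `F(s) = -s^2/2 + |s|^(p+1)/(p+1)`. -/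
noncomputable def F (p s : ℝ) : ℝ := -s ^ 2 / 2 + |s| ^ (p + 1) / (p + 1)

/-- `u : [0,∞) → ℝ` (modeled on `Set.Ici 0`) is a C² solution of the IVP
`u'' + ((n-1)/r) u' + f(u) = 0`, `u(0) = α`, `u'(0) = 0`; the data `u'`, `u''`
are its first and second derivatives on `[0,∞)`. -/
structure IsSolution (n : ℕ) (p α : ℝ) (u u' u'' : ℝ → ℝ) : Prop where
  init : u 0 = α
  initDeriv : u' 0 = 0
  hasDeriv1 : ∀ r ∈ Set.Ici (0:ℝ), HasDerivWithinAt u (u' r) (Set.Ici 0) r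
  hasDeriv2 : ∀ r ∈ Set.Ici (0:ℝ), HasDerivWithinAt u' (u'' r) (Set.Ici 0) r
  cont2 : ContinuousOn u'' (Set.Ici 0)
  ode : ∀ r : ℝ, 0 < r → u'' r + ((n : ℝ) - 1) / r * u' r + f p (u r) = 0

/-- The variation `v` associated with a solution `u`: the C² solution of the linearized
equation `v'' + ((n-1)/r) v' + f'(u) v = 0`, `v(0) = 1`, `v'(0) = 0`. -/
structure IsVariation (n : ℕ) (p : ℝ) (u v v' v'' : ℝ → ℝ) : Prop where
  init : v 0 = 1
  initDeriv : v' 0 = 0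
  hasDeriv1 : ∀ r ∈ Set.Ici (0:ℝ), HasDerivWithinAt v (v' r) (Set.Ici 0) r
  hasDeriv2 : ∀ r ∈ Set.Ici (0:ℝ), HasDerivWithinAt v' (v'' r) (Set.Ici 0) r
  cont2 : ContinuousOn v'' (Set.Ici 0)
  ode : ∀ r : ℝ, 0 < r → v'' r + ((n : ℝ) - 1) / r * v' r + fder p (u r) * v r = 0

/-- `u` is decaying: `u(r) → 0` and `u'(r) → 0` as `r → ∞`. -/
def Decaying (u u' : ℝ → ℝ) : Prop :=
  Filter.Tendsto u Filter.atTop (nhds 0) ∧ Filter.Tendsto u' Filter.atTop (nhds 0)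

/-- `u` changes sign on `(0,∞)`. -/
def ChangesSign (u : ℝ → ℝ) : Prop :=
  (∃ r : ℝ, 0 < r ∧ u r < 0) ∧ (∃ r : ℝ, 0 < r ∧ 0 < u r)

/-- `z 0 < z 1 < ⋯ < z (k-1)` are exactly the zeros of `u` in `(0,∞)`. -/
def ExactZeros (u : ℝ → ℝ) (k : ℕ) (z : Fin k → ℝ) : Prop :=
  StrictMono z ∧ (∀ i, 0 < z i ∧ u (z i) = 0) ∧
    ∀ r : ℝ, 0 < r → u r = 0 → ∃ i, r = z i

/-- The energy `E(r) = u'(r)²/2 + F(u(r))`. -/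
noncomputable def Efun (p : ℝ) (u u' : ℝ → ℝ) (r : ℝ) : ℝ := u' r ^ 2 / 2 + F p (u r)

/-- The Pohozaev function `P(r)`. -/
noncomputable def Pfun (n : ℕ) (p : ℝ) (u u' : ℝ → ℝ) (r : ℝ) : ℝ :=
  r ^ n * (u' r ^ 2 + 2 * F p (u r)) + ((n : ℝ) - 2) * r ^ (n - 1) * u r * u' r

/-- The function `P₁(r)`. -/
noncomputable def P1fun (n : ℕ) (p : ℝ) (u u' : ℝ → ℝ) (r : ℝ) : ℝ :=
  r ^ n * (u' r ^ 2 + u r * f p (u r)) + ((n : ℝ) - 2) * r ^ (n - 1) * u r * u' r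

/-- The function `P₂(r)`. -/
noncomputable def P2fun (n : ℕ) (p : ℝ) (u u' : ℝ → ℝ) (r : ℝ) : ℝ :=
  r ^ n * (u' r ^ 2 + ((n : ℝ) - 2) / (n : ℝ) * (u r * f p (u r))) +
    ((n : ℝ) - 2) * r ^ (n - 1) * u r * u' r

lemma abs_rpow_add_one {p : ℝ} (hp1 : 1 < p) (s : ℝ) :
    |s| ^ (p + 1) = |s| ^ (p - 1) * s ^ 2 := by
  rw [show p + 1 = (p - 1) + 2 by ring,
    rpow_add_of_nonneg (abs_nonneg _) (by linarith) (by norm_num), rpow_two, sq_abs]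

namespace IsSolution

variable {n : ℕ} {p α : ℝ} {u u' u'' : ℝ → ℝ}

lemma hasDerivAt (hu : IsSolution n p α u u' u'') {r : ℝ} (hr : 0 < r) :
    HasDerivAt u (u' r) r :=
  (hu.hasDeriv1 r hr.le).hasDerivAt (Ici_mem_nhds hr)

lemma hasDerivAt_deriv (hu : IsSolution n p α u u' u'') {r : ℝ} (hr : 0 < r) :
    HasDerivAt u' (u'' r) r :=
  (hu.hasDeriv2 r hr.le).hasDerivAt (Ici_mem_nhds hr)

lemma continuousOn (hu : IsSolution n p α u u' u'') : ContinuousOn u (Ici 0) :=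
  fun r hr => (hu.hasDeriv1 r hr).continuousWithinAt

lemma continuousOn_deriv (hu : IsSolution n p α u u' u'') : ContinuousOn u' (Ici 0) :=
  fun r hr => (hu.hasDeriv2 r hr).continuousWithinAt

lemma second_deriv_eq (hu : IsSolution n p α u u' u'') {r : ℝ} (hr : 0 < r) :
    u'' r = -(((n : ℝ) - 1) / r * u' r) - f p (u r) := by
  linarith [hu.ode r hr]

lemma continuousOn_abs_rpow (hu : IsSolution n p α u u' u'') {q : ℝ} (hq : 0 ≤ q) :
    ContinuousOn (fun r => |u r| ^ q) (Ici 0) :=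
  hu.continuousOn.abs.rpow_const fun _ _ => Or.inr hq

/-- Backward uniqueness: a nontrivial solution has only simple zeros. -/
lemma deriv_ne_zero_of_eq_zero (hu : IsSolution n p α u u' u'') (hp : 1 < p) (hα : 0 < α)
    {z : ℝ} (hz : 0 < z) (huz : u z = 0) : u' z ≠ 0 := by
  intro hu'z
  have vanish : ∀ a ∈ Ioo 0 z, u a = 0 := by
    intro a ha
    have hsub : Icc a z ⊆ Ici 0 := fun x hx => ha.1.le.trans hx.1
    obtain ⟨M, hM⟩ := (isCompact_Icc (a := a) (b := z)).bddAbove_image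
      ((hu.continuousOn_abs_rpow (q := p - 1) (by linarith)).mono hsub)
    have hM' : ∀ x ∈ Icc a z, |u x| ^ (p - 1) ≤ M := fun x hx => hM (mem_image_of_mem _ hx)
    have hM0 : 0 ≤ M :=
      (Real.rpow_nonneg (abs_nonneg _) _).trans (hM' a (left_mem_Icc.2 ha.2.le))
    set K : ℝ := 2 * n / a + M + 2 with hK
    have hmono : MonotoneOn (fun r => (u r ^ 2 + u' r ^ 2) * exp (K * r)) (Icc a z) := by
      refine monotoneOn_of_hasDerivWithinAt_nonneg (convex_Icc a z)
        (f' := fun r => (2 * u r * u' r + 2 * u' r * u'' r) * exp (K * r) +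
          (u r ^ 2 + u' r ^ 2) * (exp (K * r) * K)) ?_ ?_ ?_
      · have h1 := hu.continuousOn.mono hsub
        have h2 := hu.continuousOn_deriv.mono hsub
        fun_prop
      · intro x hx
        rw [interior_Icc] at hx
        have hx0 : 0 < x := ha.1.trans hx.1
        have h1 := (hu.hasDerivAt hx0).pow 2
        have h2 := (hu.hasDerivAt_deriv hx0).pow 2
        have h3 : HasDerivAt (fun r => exp (K * r)) (exp (K * x) * K) x := by
          simpa using ((hasDerivAt_id x).const_mul K).exp
        refine (((h1.add h2).mul h3).congr_deriv ?_).hasDerivWithinAt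
        simp
      · intro x hx
        rw [interior_Icc] at hx
        have hx0 : 0 < x := ha.1.trans hx.1
        have hb := hM' x ⟨hx.1.le, hx.2.le⟩
        have hb0 : 0 ≤ |u x| ^ (p - 1) := Real.rpow_nonneg (abs_nonneg _) _
        have hdiv : ((n : ℝ) - 1) / x ≤ n / a := by
          apply div_le_div₀ (by positivity) (by linarith) ha.1 hx.1.le
        have key : 0 ≤ (2 * u x * u' x + 2 * u' x * u'' x) + K * (u x ^ 2 + u' x ^ 2) := by
          rw [hu.second_deriv_eq hx0, f]
          set B := |u x| ^ (p - 1)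
          set D := ((n : ℝ) - 1) / x
          have e1 : 0 ≤ (2 * (n : ℝ) / a - 2 * D) * u' x ^ 2 :=
            mul_nonneg (by rw [mul_div_assoc]; linarith) (sq_nonneg _)
          have e2 : 0 ≤ 2 * (n : ℝ) / a * u x ^ 2 := by have := ha.1; positivity
          have e3 : 0 ≤ (M - B) * (u x ^ 2 + u' x ^ 2) :=
            mul_nonneg (by linarith) (by positivity)
          have e4 : 0 ≤ B * (u x - u' x) ^ 2 := by positivity
          have e5 : 0 ≤ (u x + u' x) ^ 2 := by positivity
          rw [hK]
          nlinarith [sq_nonneg (u x + u' x)]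
        have : 0 ≤ exp (K * x) * ((2 * u x * u' x + 2 * u' x * u'' x) +
          K * (u x ^ 2 + u' x ^ 2)) := by positivity
        linarith
    have h := hmono (left_mem_Icc.2 ha.2.le) (right_mem_Icc.2 ha.2.le) ha.2.le
    simp only [huz, hu'z] at h
    have hexp := exp_pos (K * a)
    have h' : u a ^ 2 + u' a ^ 2 ≤ 0 := by
      by_contra! hc
      nlinarith [mul_pos hc hexp]
    nlinarith [sq_nonneg (u a), sq_nonneg (u' a)]
  have hlim : Tendsto u (nhdsWithin 0 (Ioi 0)) (nhds (u 0)) :=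
    ((hu.continuousOn 0 self_mem_Ici).mono Ioi_subset_Ici_self)
  have hev : u =ᶠ[nhdsWithin 0 (Ioi 0)] fun _ => 0 := by
    filter_upwards [Ioo_mem_nhdsGT hz] with a ha using vanish a ha
  have := tendsto_nhds_unique hlim (tendsto_const_nhds.congr' hev.symm)
  rw [hu.init] at this
  linarith

lemma hasDerivAt_F_comp (hu : IsSolution n p α u u' u'') (hp : 1 < p) {r : ℝ} (hr : 0 < r) :
    HasDerivAt (fun r => F p (u r)) (f p (u r) * u' r) r := by
  have h1 := (hasDerivAt_abs_rpow (u r) (p := p + 1) (by linarith)).comp r (hu.hasDerivAt hr)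
  have h2 := (hu.hasDerivAt hr).pow 2
  have h3 := (h2.neg.div_const 2).add (h1.div_const (p + 1))
  refine h3.congr_deriv ?_
  have : p + 1 ≠ 0 := by linarith
  rw [f, show p + 1 - 2 = p - 1 by ring]
  field_simp
  push_cast
  ring

lemma hasDerivAt_f_comp_mul (hu : IsSolution n p α u u' u'') (hp : 1 < p) {r : ℝ}
    (hr : 0 < r) : HasDerivAt (fun r => u r * f p (u r))
      ((-2 + (p + 1) * |u r| ^ (p - 1)) * u r * u' r) r := by
  have h1 := (hasDerivAt_abs_rpow (u r) (p := p + 1) (by linarith)).comp r (hu.hasDerivAt hr)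
  have h2 := (hu.hasDerivAt hr).pow 2
  have h3 := h2.neg.add h1
  refine (h3.congr_deriv ?_).congr_of_eventuallyEq (Eventually.of_forall fun s => ?_)
  · rw [show p + 1 - 2 = p - 1 by ring]
    push_cast
    ring
  · simp only [f, Pi.add_apply, Pi.neg_apply, Pi.pow_apply, Function.comp_apply]
    rw [abs_rpow_add_one hp]
    ring

lemma continuousOn_F_comp (hu : IsSolution n p α u u' u'') (hp : 1 < p) :
    ContinuousOn (fun r => F p (u r)) (Ici 0) := by
  have h1 := hu.continuousOn
  have h2 := hu.continuousOn_abs_rpow (q := p + 1) (by linarith)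
  unfold F
  fun_prop

lemma continuousOn_f_comp (hu : IsSolution n p α u u' u'') (hp : 1 < p) :
    ContinuousOn (fun r => f p (u r)) (Ici 0) := by
  have h1 := hu.continuousOn
  have h2 := hu.continuousOn_abs_rpow (q := p - 1) (by linarith)
  unfold f
  fun_prop

lemma hasDerivAt_Efun (hu : IsSolution n p α u u' u'') (hp : 1 < p) {r : ℝ} (hr : 0 < r) :
    HasDerivAt (Efun p u u') (-(((n : ℝ) - 1) / r * u' r ^ 2)) r := by
  have h := (((hu.hasDerivAt_deriv hr).pow 2).div_const 2).add (hu.hasDerivAt_F_comp hp hr)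
  refine h.congr_deriv ?_
  rw [hu.second_deriv_eq hr]
  push_cast
  ring

lemma antitoneOn_Efun (hu : IsSolution n p α u u' u'') (hn : 3 ≤ n) (hp : 1 < p) :
    AntitoneOn (Efun p u u') (Ioi 0) := by
  have hn' : (3 : ℝ) ≤ n := by exact_mod_cast hn
  refine antitoneOn_of_hasDerivWithinAt_nonpos (convex_Ioi 0)
    (f' := fun r => -(((n : ℝ) - 1) / r * u' r ^ 2)) ?_ ?_ ?_
  · exact fun r hr => (hu.hasDerivAt_Efun hp hr).continuousAt.continuousWithinAt
  · intro r hr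
    rw [interior_Ioi] at hr
    exact (hu.hasDerivAt_Efun hp hr).hasDerivWithinAt
  · intro r hr
    rw [interior_Ioi] at hr
    have : 0 ≤ ((n : ℝ) - 1) / r := div_nonneg (by linarith) (le_of_lt hr)
    have := mul_nonneg this (sq_nonneg (u' r))
    linarith

lemma Efun_pos_of_le_zero (hu : IsSolution n p α u u' u'') (hn : 3 ≤ n) (hp : 1 < p)
    (hα : 0 < α) {r z : ℝ} (hr : 0 < r) (hrz : r ≤ z) (huz : u z = 0) : 0 < Efun p u u' r := by
  have hz : 0 < z := hr.trans_le hrz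
  have h := hu.antitoneOn_Efun hn hp hr hz hrz
  have h' := hu.deriv_ne_zero_of_eq_zero hp hα hz huz
  refine lt_of_lt_of_le ?_ h
  have : p + 1 ≠ 0 := by linarith
  simp only [Efun, F, huz, abs_zero, zero_rpow this]
  have := sq_pos_of_ne_zero h'
  simpa using this

lemma Efun_pos_of_decaying (hu : IsSolution n p α u u' u'') (hn : 3 ≤ n) (hp : 1 < p)
    (hα : 0 < α) (hd : Decaying u u') {r : ℝ} (hr : 0 < r) : 0 < Efun p u u' r := by
  have hn' : (3 : ℝ) ≤ n := by exact_mod_cast hn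
  have hp1 : p + 1 ≠ 0 := by linarith
  have hlim : Tendsto (Efun p u u') atTop (nhds 0) := by
    have h1 : Tendsto (fun r => |u r| ^ (p + 1)) atTop (nhds 0) := by
      simpa [zero_rpow hp1] using hd.1.abs.rpow_const (p := p + 1) (Or.inr (by linarith))
    have h2 := ((hd.2.pow 2).div_const 2).add (((hd.1.pow 2).neg.div_const 2).add
      (h1.div_const (p + 1)))
    simpa using (show Tendsto (Efun p u u') atTop _ from h2)
  have hanti := hu.antitoneOn_Efun hn hp
  have hnonneg : ∀ s, 0 < s → 0 ≤ Efun p u u' s := fun s hs =>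
    le_of_tendsto hlim (by
      filter_upwards [eventually_ge_atTop s] with t ht using hanti hs (hs.trans_le ht) ht)
  refine lt_of_le_of_ne (hnonneg r hr) fun h0 => ?_
  have hE : ∀ s, r ≤ s → Efun p u u' s = 0 := fun s hs =>
    le_antisymm (h0 ▸ hanti hr (hr.trans_le hs) hs) (hnonneg s (hr.trans_le hs))
  have hu' : ∀ s, r < s → u' s = 0 := by
    intro s hs
    have hs0 := hr.trans hs
    have hconst : HasDerivAt (Efun p u u') 0 s :=
      (hasDerivAt_const s (0 : ℝ)).congr_of_eventuallyEq (by
        filter_upwards [Ioi_mem_nhds hs] with t ht using hE t (le_of_lt ht))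
    have h := (hu.hasDerivAt_Efun hp hs0).unique hconst
    have hpos : 0 < ((n : ℝ) - 1) / s := div_pos (by linarith) hs0
    have : u' s ^ 2 = 0 := by
      by_contra hne
      have := mul_pos hpos (lt_of_le_of_ne (sq_nonneg (u' s)) (Ne.symm hne))
      linarith
    simpa using this
  have hconst : ∀ s ∈ Ioi r, ∀ t ∈ Ioi r, u s = u t := by
    intro s hs t ht
    refine (convex_Ioi r).is_const_of_fderivWithin_eq_zero (𝕜 := ℝ)
      (fun x hx => (hu.hasDerivAt (hr.trans hx)).differentiableAt.differentiableWithinAt)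
      (fun x hx => ?_) hs ht
    have := (hu.hasDerivAt (hr.trans hx)).hasFDerivAt.hasFDerivWithinAt (s := Ioi r)
    rw [this.fderivWithin (isOpen_Ioi.uniqueDiffWithinAt hx), hu' x hx]
    ext
    simp
  have hu0 : u (r + 1) = 0 := by
    refine tendsto_nhds_unique (tendsto_const_nhds.congr' ?_) hd.1
    filter_upwards [eventually_gt_atTop r] with t ht using hconst _ (by simp) _ ht
  exact hu.deriv_ne_zero_of_eq_zero hp hα (by linarith) hu0 (hu' _ (by linarith))

end IsSolution

/-- The coefficient of `|s|^(p+1)` in `2 n F(s) - (n-2) s f(s)`, positive for subcritical `p`. -/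
noncomputable def pohozaevCoeff (n : ℕ) (p : ℝ) : ℝ := 2 * n / (p + 1) - (n - 2)

lemma pohozaevCoeff_pos {n : ℕ} {p : ℝ} (hn : 3 ≤ n) (hp1 : 1 < p)
    (hp2 : p < ((n : ℝ) + 2) / ((n : ℝ) - 2)) : 0 < pohozaevCoeff n p := by
  have hn' : (3 : ℝ) ≤ n := by exact_mod_cast hn
  rw [lt_div_iff₀ (by linarith)] at hp2
  rw [pohozaevCoeff, sub_pos, lt_div_iff₀ (by linarith)]
  linarith

lemma pohozaevCoeff_mul_lt {n : ℕ} {p : ℝ} (hn : 3 ≤ n) (hp1 : 1 < p) :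
    pohozaevCoeff n p * (p + 1) < 4 := by
  have hn' : (3 : ℝ) ≤ n := by exact_mod_cast hn
  have : p + 1 ≠ 0 := by linarith
  rw [pohozaevCoeff, sub_mul, div_mul_cancel₀ _ this]
  nlinarith

lemma pohozaev_density_eq {p : ℝ} (n : ℕ) (hp1 : 1 < p) (s : ℝ) :
    2 * n * F p s - (n - 2) * (s * f p s) =
      s ^ 2 * (pohozaevCoeff n p * |s| ^ (p - 1) - 2) := by
  have : p + 1 ≠ 0 := by linarith
  rw [F, f, abs_rpow_add_one hp1, pohozaevCoeff]
  field_simp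
  ring

namespace IsSolution

variable {n : ℕ} {p α : ℝ} {u u' u'' : ℝ → ℝ}

lemma continuousOn_Pfun (hu : IsSolution n p α u u' u'') (hp : 1 < p) :
    ContinuousOn (Pfun n p u u') (Ici 0) := by
  have h1 := hu.continuousOn
  have h2 := hu.continuousOn_deriv
  have h3 := hu.continuousOn_F_comp hp
  unfold Pfun
  fun_prop

lemma continuousOn_P2fun (hu : IsSolution n p α u u' u'') (hp : 1 < p) :
    ContinuousOn (P2fun n p u u') (Ici 0) := by
  have h1 := hu.continuousOn
  have h2 := hu.continuousOn_deriv
  have h3 := hu.continuousOn_f_comp hp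
  unfold P2fun
  fun_prop

lemma hasDerivAt_Pfun (hu : IsSolution n p α u u' u'') (hn : 3 ≤ n) (hp : 1 < p) {r : ℝ}
    (hr : 0 < r) : HasDerivAt (Pfun n p u u')
      (r ^ (n - 1) * (u r ^ 2 * (pohozaevCoeff n p * |u r| ^ (p - 1) - 2))) r := by
  rw [← pohozaev_density_eq n hp]
  have hd := hu.hasDerivAt hr
  have hd' := hu.hasDerivAt_deriv hr
  have hode := hu.second_deriv_eq hr
  have hF := hu.hasDerivAt_F_comp hp hr
  obtain ⟨N, rfl⟩ : ∃ N, n = N + 2 := ⟨n - 2, by omega⟩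
  have h := ((hasDerivAt_pow (N + 2) r).mul ((hd'.pow 2).add (hF.const_mul 2))).add
    ((((hasDerivAt_pow (N + 1) r).const_mul (((N + 2 : ℕ) : ℝ) - 2)).mul hd).mul hd')
  refine h.congr_deriv ?_
  rw [hode]
  simp only [Nat.add_succ_sub_one, add_tsub_cancel_right, Pi.add_apply, Pi.pow_apply, Pi.mul_apply]
  push_cast
  field_simp
  ring

lemma hasDerivAt_P2fun (hu : IsSolution n p α u u' u'') (hn : 3 ≤ n) (hp : 1 < p) {r : ℝ}
    (hr : 0 < r) : HasDerivAt (P2fun n p u u')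
      (-(r ^ n / n * (pohozaevCoeff n p * (p + 1) * |u r| ^ (p - 1) - 4) * (u r * u' r))) r := by
  have hd := hu.hasDerivAt hr
  have hd' := hu.hasDerivAt_deriv hr
  have hode := hu.second_deriv_eq hr
  have hf := hu.hasDerivAt_f_comp_mul hp hr
  have hcoeff : pohozaevCoeff n p * (p + 1) = 2 * n - (n - 2) * (p + 1) := by
    have : p + 1 ≠ 0 := by linarith
    rw [pohozaevCoeff, sub_mul, div_mul_cancel₀ _ this]
  rw [hcoeff]
  obtain ⟨N, rfl⟩ : ∃ N, n = N + 2 := ⟨n - 2, by omega⟩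
  have h := ((hasDerivAt_pow (N + 2) r).mul ((hd'.pow 2).add
    (hf.const_mul ((((N + 2 : ℕ) : ℝ) - 2) / ((N + 2 : ℕ) : ℝ))))).add
    ((((hasDerivAt_pow (N + 1) r).const_mul (((N + 2 : ℕ) : ℝ) - 2)).mul hd).mul hd')
  refine h.congr_deriv ?_
  rw [hode]
  simp only [f, Nat.add_succ_sub_one, add_tsub_cancel_right, Pi.add_apply, Pi.pow_apply, Pi.mul_apply]
  push_cast
  have : (N : ℝ) + 2 ≠ 0 := by positivity
  field_simp
  ring

lemma strictAntiOn_sq (hu : IsSolution n p α u u' u'') {a b : ℝ} (ha : 0 ≤ a)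
    (h : ∀ s ∈ Ioo a b, u s * u' s < 0) : StrictAntiOn (fun r => u r ^ 2) (Icc a b) := by
  refine strictAntiOn_of_hasDerivWithinAt_neg (convex_Icc a b)
    (f' := fun r => 2 * (u r * u' r)) ?_ ?_ ?_
  · exact (hu.continuousOn.mono fun x hx => ha.trans hx.1).pow 2
  · intro s hs
    rw [interior_Icc] at hs
    refine (((hu.hasDerivAt (ha.trans_lt hs.1)).pow 2).congr_deriv ?_).hasDerivWithinAt
    push_cast
    ring
  · intro s hs
    rw [interior_Icc] at hs
    linarith [h s hs]

lemma abs_lt_abs (hu : IsSolution n p α u u' u'') {a b : ℝ} (ha : 0 ≤ a) (hab : a < b)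
    (h : ∀ s ∈ Ioo a b, u s * u' s < 0) : |u b| < |u a| :=
  sq_lt_sq.1 (hu.strictAntiOn_sq ha h (left_mem_Icc.2 hab.le) (right_mem_Icc.2 hab.le) hab)

/-- A point where `u²` decreases lies on a decreasing arc that starts at a critical point. -/
lemma exists_critical_left (hu : IsSolution n p α u u' u'') {r : ℝ} (hr : 0 < r)
    (h : u r * u' r < 0) :
    ∃ a, 0 ≤ a ∧ a < r ∧ u' a = 0 ∧ ∀ s ∈ Ioc a r, u s * u' s < 0 := by
  have hcont : ContinuousOn (fun s => u s * u' s) (Icc 0 r) :=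
    (hu.continuousOn.mul hu.continuousOn_deriv).mono fun x hx => hx.1
  have hcomp : IsCompact (Icc 0 r ∩ (fun s => u s * u' s) ⁻¹' Ici 0) :=
    isCompact_Icc.of_isClosed_subset (hcont.preimage_isClosed_of_isClosed isClosed_Icc isClosed_Ici)
      inter_subset_left
  obtain ⟨a, ⟨ha, ha'⟩, hmax⟩ := hcomp.exists_isGreatest
    ⟨0, ⟨left_mem_Icc.2 hr.le, by simp [hu.initDeriv]⟩⟩
  have har : a < r := lt_of_le_of_ne ha.2 (by rintro rfl; exact absurd h (not_lt.2 ha'))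
  have hneg : ∀ s ∈ Ioc a r, u s * u' s < 0 := by
    intro s hs
    by_contra! hc
    exact absurd (hmax ⟨⟨ha.1.trans hs.1.le, hs.2⟩, hc⟩) (not_le.2 hs.1)
  obtain ⟨c, hc, hc0⟩ := intermediate_value_Icc' har.le
    (hcont.mono (Icc_subset_Icc_left ha.1)) ⟨h.le, ha'⟩
  have hca : c = a := le_antisymm (hmax ⟨⟨ha.1.trans hc.1, hc.2⟩, hc0.ge⟩) hc.1
  subst hca
  refine ⟨c, ha.1, har, ?_, hneg⟩
  have hlt := hu.abs_lt_abs ha.1 har fun s hs => hneg s ⟨hs.1, hs.2.le⟩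
  have : u c ≠ 0 := abs_pos.1 ((abs_nonneg _).trans_lt hlt)
  exact (mul_eq_zero.1 hc0).resolve_left this

lemma exists_zero_right (hu : IsSolution n p α u u' u'') {r t : ℝ} (hr : 0 < r)
    (hrt : r ≤ t) (h : u r * u' r < 0) (ht : 0 ≤ u t * u' t) :
    ∃ b, r < b ∧ b ≤ t ∧ u b * u' b = 0 ∧ ∀ s ∈ Ico r b, u s * u' s < 0 := by
  have hcont : ContinuousOn (fun s => u s * u' s) (Icc r t) :=
    (hu.continuousOn.mul hu.continuousOn_deriv).mono fun x hx => hr.le.trans hx.1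
  have hcomp : IsCompact (Icc r t ∩ (fun s => u s * u' s) ⁻¹' Ici 0) :=
    isCompact_Icc.of_isClosed_subset (hcont.preimage_isClosed_of_isClosed isClosed_Icc isClosed_Ici)
      inter_subset_left
  obtain ⟨b, ⟨hb, hb'⟩, hmin⟩ := hcomp.exists_isLeast ⟨t, ⟨right_mem_Icc.2 hrt, ht⟩⟩
  have hrb : r < b := lt_of_le_of_ne hb.1 (by rintro rfl; exact absurd h (not_lt.2 hb'))
  obtain ⟨c, hc, hc0⟩ := intermediate_value_Icc hrb.le
    (hcont.mono (Icc_subset_Icc_right hb.2)) ⟨h.le, hb'⟩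
  have hcb : c = b := le_antisymm hc.2 (hmin ⟨⟨hc.1, hc.2.trans hb.2⟩, hc0.ge⟩)
  subst hcb
  refine ⟨c, hrb, hb.2, hc0, fun s hs => ?_⟩
  by_contra! hc
  exact absurd (hmin ⟨⟨hs.1, hs.2.le.trans hb.2⟩, hc⟩) (not_le.2 hs.2)

lemma Pfun_eq (r : ℝ) : Pfun n p u u' r =
    2 * r ^ n * Efun p u u' r + ((n : ℝ) - 2) * (r ^ (n - 1) * (u r * u' r)) := by
  rw [Pfun, Efun]
  ring

lemma Pfun_pos_of_mul_nonneg (hn : 3 ≤ n) {r : ℝ} (hr : 0 < r) (hE : 0 < Efun p u u' r)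
    (h : 0 ≤ u r * u' r) : 0 < Pfun n p u u' r := by
  have hn' : (3 : ℝ) ≤ n := by exact_mod_cast hn
  have : (0 : ℝ) ≤ n - 2 := by linarith
  rw [Pfun_eq]
  positivity

/-- Exponential decay of a solution whose square decreases to zero. -/
lemma exists_sq_le_exp (hu : IsSolution n p α u u' u'') (hn : 3 ≤ n) (hp : 1 < p)
    (hd : Decaying u u') {R : ℝ} (hR : 0 < R) (hneg : ∀ s, R ≤ s → u s * u' s < 0) :
    ∃ C R', R ≤ R' ∧ 0 ≤ C ∧ ∀ s, R' ≤ s → u s ^ 2 ≤ C * exp (-s) := by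
  have hn' : (3 : ℝ) ≤ n := by exact_mod_cast hn
  have hlim : Tendsto (fun r => |u r| ^ (p - 1)) atTop (nhds 0) := by
    simpa [zero_rpow (by linarith : p - 1 ≠ 0)] using
      hd.1.abs.rpow_const (p := p - 1) (Or.inr (by linarith))
  obtain ⟨R₁, hR₁⟩ := eventually_atTop.1
    (hlim.eventually (gt_mem_nhds (by norm_num : (0 : ℝ) < 1 / 2)))
  set R' := max R R₁
  have hR' : 0 < R' := hR.trans_le (le_max_left _ _)
  have hd1 : ∀ s, R' ≤ s → HasDerivAt (fun r => u r ^ 2) (2 * (u s * u' s)) s := by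
    intro s hs
    refine ((hu.hasDerivAt (hR'.trans_le hs)).pow 2).congr_deriv ?_
    push_cast
    ring
  have hd2 : ∀ s, R' ≤ s → HasDerivAt (fun r => u r ^ 2 + 2 * (u r * u' r))
      (2 * (u s * u' s) + 2 * (u' s * u' s + u s * u'' s)) s := fun s hs =>
    (hd1 s hs).add (((hu.hasDerivAt (hR'.trans_le hs)).mul
      (hu.hasDerivAt_deriv (hR'.trans_le hs))).const_mul 2)
  have hexp : ∀ s : ℝ, HasDerivAt (fun r : ℝ => exp (-r)) (-exp (-s)) s := fun s => by
    simpa using (hasDerivAt_neg s).exp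
  have hmono : MonotoneOn (fun r => (u r ^ 2 + 2 * (u r * u' r)) * exp (-r)) (Ici R') := by
    refine monotoneOn_of_hasDerivWithinAt_nonneg (convex_Ici R')
      (fun s hs => ((hd2 s hs).mul (hexp s)).continuousAt.continuousWithinAt)
      (fun s hs => ((hd2 s (interior_subset hs)).mul (hexp s)).hasDerivWithinAt) ?_
    intro s hs
    have hs' : R' ≤ s := interior_subset hs
    have hs0 : 0 < s := hR'.trans_le hs'
    have hB := hR₁ s ((le_max_right _ _).trans hs')
    have hN := hneg s ((le_max_left _ _).trans hs')
    have key : 0 ≤ (2 * (u s * u' s) + 2 * (u' s * u' s + u s * u'' s)) -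
        (u s ^ 2 + 2 * (u s * u' s)) := by
      rw [hu.second_deriv_eq hs0, f]
      have e1 : 0 ≤ ((n : ℝ) - 1) / s * -(u s * u' s) :=
        mul_nonneg (div_nonneg (by linarith) hs0.le) (by linarith)
      have e2 : 0 ≤ (1 / 2 - |u s| ^ (p - 1)) * u s ^ 2 :=
        mul_nonneg (by linarith) (sq_nonneg _)
      nlinarith [sq_nonneg (u' s)]
    have := mul_nonneg key (exp_pos (-s)).le
    linarith
  have hnonpos : ∀ s, R' ≤ s → u s ^ 2 + 2 * (u s * u' s) ≤ 0 := by
    intro s hs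
    have hl : Tendsto (fun r => (u r ^ 2 + 2 * (u r * u' r)) * exp (-r)) atTop (nhds 0) := by
      simpa using ((hd.1.pow 2).add ((hd.1.mul hd.2).const_mul 2)).mul
        tendsto_exp_neg_atTop_nhds_zero
    have h := ge_of_tendsto hl (b := (u s ^ 2 + 2 * (u s * u' s)) * exp (-s)) (by
      filter_upwards [eventually_ge_atTop s] with t ht using hmono hs (hs.trans ht) ht)
    exact nonpos_of_mul_nonpos_left h (exp_pos _)
  have hanti : AntitoneOn (fun r => u r ^ 2 * exp r) (Ici R') := by
    refine antitoneOn_of_hasDerivWithinAt_nonpos (convex_Ici R')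
      (fun s hs => ((hd1 s hs).mul (Real.hasDerivAt_exp s)).continuousAt.continuousWithinAt)
      (fun s hs => ((hd1 s (interior_subset hs)).mul (Real.hasDerivAt_exp s)).hasDerivWithinAt) ?_
    intro s hs
    have := mul_nonpos_of_nonpos_of_nonneg (hnonpos s (interior_subset hs)) (exp_pos s).le
    linarith
  refine ⟨u R' ^ 2 * exp R', R', le_max_left _ _, by positivity, fun s hs => ?_⟩
  have h : u s ^ 2 * exp s ≤ u R' ^ 2 * exp R' := hanti self_mem_Ici hs hs
  rwa [exp_neg, ← div_eq_mul_inv, le_div_iff₀ (exp_pos s)]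

lemma exists_neg_lt_pow_mul (hu : IsSolution n p α u u' u'') (hn : 3 ≤ n) (hp : 1 < p)
    (hd : Decaying u u') {R : ℝ} (hR : 0 < R) (hneg : ∀ s, R ≤ s → u s * u' s < 0)
    (m : ℕ) {δ : ℝ} (hδ : 0 < δ) : ∃ r, R ≤ r ∧ -δ < r ^ m * (u r * u' r) := by
  obtain ⟨C, R', hRR', hC, hexp⟩ := hu.exists_sq_le_exp hn hp hd hR hneg
  have hlim : Tendsto (fun t : ℝ => t ^ m * exp (-t) * (C * exp 1)) atTop (nhds 0) := by
    simpa using (tendsto_pow_mul_exp_neg_atTop_nhds_zero m).mul_const (C * exp 1)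
  obtain ⟨t, ht, htR⟩ := ((hlim.eventually (gt_mem_nhds hδ)).and
    (eventually_ge_atTop (R' + 1))).exists
  have hpos : 0 < t - 1 := by linarith
  obtain ⟨ξ, hξ, hslope⟩ := exists_hasDerivAt_eq_slope (fun r => u r ^ 2)
    (fun r => 2 * (u r * u' r)) (sub_one_lt t)
    ((hu.continuousOn.mono fun x hx => hpos.le.trans hx.1).pow 2)
    (fun x hx => ((hu.hasDerivAt (hpos.trans hx.1)).pow 2).congr_deriv (by push_cast; ring))
  have hξ0 : 0 < ξ := hpos.trans hξ.1
  have ht0 : 0 < t := by linarith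
  refine ⟨ξ, by linarith [hξ.1], ?_⟩
  have h1 := hexp (t - 1) (by linarith)
  rw [show -(t - 1) = -t + 1 by ring, exp_add] at h1
  rw [show t - (t - 1) = 1 by ring, div_one] at hslope
  have h2 : -(u ξ * u' ξ) ≤ C * (exp (-t) * exp 1) := by
    nlinarith [sq_nonneg (u t), hneg ξ (by linarith [hξ.1])]
  have h3 : ξ ^ m ≤ t ^ m := pow_le_pow_left₀ hξ0.le hξ.2.le m
  have h4 : ξ ^ m * -(u ξ * u' ξ) ≤ t ^ m * (C * (exp (-t) * exp 1)) :=
    mul_le_mul h3 h2 (by linarith [hneg ξ (by linarith [hξ.1])]) (by positivity)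
  linarith

lemma Pfun_pos (hu : IsSolution n p α u u' u'') (hn : 3 ≤ n) (hp : 1 < p)
    (hp2 : p < ((n : ℝ) + 2) / ((n : ℝ) - 2)) {r : ℝ} (hr : 0 < r)
    (hend : Decaying u u' ∨ ∃ z, r ≤ z ∧ u z = 0)
    (hE : ∀ s, 0 < s → (Decaying u u' ∨ ∃ z, s ≤ z ∧ u z = 0) → 0 < Efun p u u' s) :
    0 < Pfun n p u u' r := by
  have hn' : (3 : ℝ) ≤ n := by exact_mod_cast hn
  have hc := pohozaevCoeff_pos hn hp hp2
  rcases le_or_gt 0 (u r * u' r) with hsign | hsign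
  · exact Pfun_pos_of_mul_nonneg hn hr (hE r hr hend) hsign
  by_contra! hP
  obtain ⟨a, ha0, har, hua, harc⟩ := hu.exists_critical_left hr hsign
  have hPa : 0 ≤ Pfun n p u u' a := by
    rcases ha0.eq_or_lt with rfl | ha
    · have : n ≠ 0 := by omega
      simp [Pfun, hua, this]
    · refine (Pfun_pos_of_mul_nonneg hn ha (hE a ha ?_) (by simp [hua])).le
      exact hend.imp_right fun ⟨z, hz, hz'⟩ => ⟨z, har.le.trans hz, hz'⟩
  obtain ⟨ξ, hξ, hslope⟩ := exists_hasDerivAt_eq_slope (Pfun n p u u') _ har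
    ((hu.continuousOn_Pfun hp).mono fun x hx => ha0.trans hx.1)
    (fun x hx => hu.hasDerivAt_Pfun hn hp (ha0.trans_lt hx.1))
  have hξ0 : 0 < ξ := ha0.trans_lt hξ.1
  have hξu : u ξ ≠ 0 := fun h => by simpa [h] using harc ξ ⟨hξ.1, hξ.2.le⟩
  have hsub : pohozaevCoeff n p * |u ξ| ^ (p - 1) - 2 ≤ 0 := by
    have hle : ξ ^ (n - 1) * (u ξ ^ 2 * (pohozaevCoeff n p * |u ξ| ^ (p - 1) - 2)) ≤ 0 := by
      rw [hslope]
      exact div_nonpos_of_nonpos_of_nonneg (by linarith) (by linarith)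
    by_contra! hcon
    have : 0 < ξ ^ (n - 1) * (u ξ ^ 2 * (pohozaevCoeff n p * |u ξ| ^ (p - 1) - 2)) :=
      mul_pos (pow_pos hξ0 _) (mul_pos (sq_pos_of_ne_zero hξu) hcon)
    linarith
  have hdecr : ∀ b, r < b → (∀ s ∈ Ico r b, u s * u' s < 0) →
      StrictAntiOn (Pfun n p u u') (Icc r b) := by
    intro b hb hneg
    refine strictAntiOn_of_hasDerivWithinAt_neg (convex_Icc r b)
      ((hu.continuousOn_Pfun hp).mono fun x hx => hr.le.trans hx.1)
      (fun x hx => (hu.hasDerivAt_Pfun hn hp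
        (hr.trans_le (interior_subset hx).1)).hasDerivWithinAt) ?_
    intro x hx
    rw [interior_Icc] at hx
    have hx0 : 0 < x := hr.trans hx.1
    have hux : u x ≠ 0 := fun h => by simpa [h] using hneg x ⟨hx.1.le, hx.2⟩
    have hlt : |u x| < |u ξ| := hu.abs_lt_abs hξ0.le (hξ.2.trans hx.1) fun s hs => by
      rcases le_or_gt s r with hsr | hsr
      · exact harc s ⟨hξ.1.trans hs.1, hsr⟩
      · exact hneg s ⟨hsr.le, hs.2.trans hx.2⟩
    have hpow := rpow_lt_rpow (abs_nonneg _) hlt (by linarith : 0 < p - 1)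
    have hneg' : pohozaevCoeff n p * |u x| ^ (p - 1) - 2 < 0 := by
      linarith [mul_lt_mul_of_pos_left hpow hc]
    have := mul_pos (mul_pos (pow_pos hx0 (n - 1)) (sq_pos_of_ne_zero hux)) (neg_pos.2 hneg')
    linarith
  by_cases hex : ∃ t, r ≤ t ∧ 0 ≤ u t * u' t ∧ (Decaying u u' ∨ ∃ z, t ≤ z ∧ u z = 0)
  · obtain ⟨t, hrt, ht, htend⟩ := hex
    obtain ⟨b, hrb, hbt, hb0, hneg⟩ := hu.exists_zero_right hr hrt hsign ht
    have hb : 0 < b := hr.trans hrb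
    have hPb := Pfun_pos_of_mul_nonneg hn hb (hE b hb (htend.imp_right
      fun ⟨z, hz, hz'⟩ => ⟨z, hbt.trans hz, hz'⟩)) hb0.ge
    have := hdecr b hrb hneg (left_mem_Icc.2 hrb.le) (right_mem_Icc.2 hrb.le) hrb
    linarith
  · push Not at hex
    have hd : Decaying u u' := hend.resolve_right fun ⟨z, hz, hz'⟩ =>
      (hex z hz (by simp [hz'])).2 z le_rfl hz'
    have hneg : ∀ s, r ≤ s → u s * u' s < 0 := by
      intro s hs
      by_contra! h
      exact (hex s hs h).1 hd
    have hlt : ∀ s t, r ≤ s → s < t → Pfun n p u u' t < Pfun n p u u' s := fun s t hs hst =>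
      hdecr t (hs.trans_lt hst) (fun x hx => hneg x hx.1) ⟨hs, hst.le⟩
        (right_mem_Icc.2 (hs.trans hst.le)) hst
    have hδ : 0 < -Pfun n p u u' (r + 1) := by linarith [hlt r (r + 1) le_rfl (by linarith)]
    obtain ⟨s, hs, hs'⟩ := hu.exists_neg_lt_pow_mul hn hp hd (R := r + 1 + 1) (by linarith)
      (fun s hs => hneg s (by linarith)) (n - 1) (div_pos hδ (by linarith : (0 : ℝ) < n - 2))
    have hs0 : 0 < s := by linarith
    have h1 := hlt (r + 1) s (by linarith) (by linarith)
    rw [Pfun_eq s] at h1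
    have h2 : 0 < 2 * s ^ n * Efun p u u' s := by
      have := hE s hs0 (Or.inl hd)
      positivity
    rw [← neg_div, neg_neg, div_lt_iff₀ (by linarith)] at hs'
    linarith

lemma P1fun_pos (hp : 1 < p) {r : ℝ} (hr : 0 < r) (hP : 0 < Pfun n p u u' r) :
    0 < P1fun n p u u' r := by
  have hp' : p + 1 ≠ 0 := by linarith
  have hB : 0 ≤ |u r| ^ (p - 1) := rpow_nonneg (abs_nonneg _) _
  have h : P1fun n p u u' r = Pfun n p u u' r +
      r ^ n * ((p - 1) / (p + 1) * (|u r| ^ (p - 1) * u r ^ 2)) := by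
    rw [P1fun, Pfun, F, f, abs_rpow_add_one hp]
    field_simp
    ring
  have : 0 ≤ (p - 1) / (p + 1) := div_nonneg (by linarith) (by linarith)
  rw [h]
  positivity

lemma P2fun_eq (hn : 3 ≤ n) (hp : 1 < p) (r : ℝ) : P2fun n p u u' r = Pfun n p u u' r -
    r ^ n / n * (u r ^ 2 * (pohozaevCoeff n p * |u r| ^ (p - 1) - 2)) := by
  have : (n : ℝ) ≠ 0 := by norm_cast; omega
  rw [← pohozaev_density_eq n hp, P2fun, Pfun]
  field_simp
  ring

lemma P2fun_pos (hu : IsSolution n p α u u' u'') (hn : 3 ≤ n) (hp : 1 < p)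
    (hp2 : p < ((n : ℝ) + 2) / ((n : ℝ) - 2)) {r : ℝ} (hr : 0 < r)
    (hP : 0 < Pfun n p u u' r) : 0 < P2fun n p u u' r := by
  have hn' : (3 : ℝ) ≤ n := by exact_mod_cast hn
  have hc := pohozaevCoeff_pos hn hp hp2
  have hc4 := pohozaevCoeff_mul_lt hn hp
  rcases le_or_gt (pohozaevCoeff n p * |u r| ^ (p - 1)) 2 with hsmall | hlarge
  · rw [P2fun_eq hn hp]
    have : 0 ≤ r ^ n / n * (u r ^ 2 * (2 - pohozaevCoeff n p * |u r| ^ (p - 1))) :=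
      mul_nonneg (by positivity) (mul_nonneg (sq_nonneg _) (by linarith))
    linarith
  have hge : ∀ s, |u r| ≤ |u s| → 1 < |u s| ^ (p - 1) ∧
      2 < pohozaevCoeff n p * |u s| ^ (p - 1) := by
    intro s hs
    have h1 := rpow_le_rpow (abs_nonneg _) hs (by linarith : 0 ≤ p - 1)
    have h2 := mul_le_mul_of_nonneg_left h1 hc.le
    refine ⟨?_, hlarge.trans_le h2⟩
    by_contra! h3
    nlinarith
  have hterm : ∀ s, |u r| ≤ |u s| → 0 ≤ ((n : ℝ) - 2) / n * (u s * f p (u s)) := by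
    intro s hs
    have h : u s * f p (u s) = u s ^ 2 * (|u s| ^ (p - 1) - 1) := by rw [f]; ring
    rw [h]
    exact mul_nonneg (div_nonneg (by linarith) (by linarith))
      (mul_nonneg (sq_nonneg _) (by linarith [(hge s hs).1]))
  rcases le_or_gt 0 (u r * u' r) with hsign | hsign
  · have hur : u r ≠ 0 := by
      intro h0
      have := (hge r le_rfl).1
      rw [h0, abs_zero, zero_rpow (by linarith)] at this
      linarith
    have hterm' : 0 < ((n : ℝ) - 2) / n * (u r * f p (u r)) := by
      have h : u r * f p (u r) = u r ^ 2 * (|u r| ^ (p - 1) - 1) := by rw [f]; ring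
      rw [h]
      exact mul_pos (div_pos (by linarith) (by linarith))
        (mul_pos (sq_pos_of_ne_zero hur) (by linarith [(hge r le_rfl).1]))
    have h1 : 0 < r ^ n * (u' r ^ 2 + ((n : ℝ) - 2) / n * (u r * f p (u r))) := by positivity
    have h2 : 0 ≤ ((n : ℝ) - 2) * r ^ (n - 1) * (u r * u' r) :=
      mul_nonneg (mul_nonneg (by linarith) (by positivity)) hsign
    rw [P2fun]
    linarith
  obtain ⟨a, ha0, har, hua, harc⟩ := hu.exists_critical_left hr hsign
  have hlt : ∀ s, a ≤ s → s < r → |u r| < |u s| := fun s has hsr =>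
    hu.abs_lt_abs (ha0.trans has) hsr fun x hx => harc x ⟨has.trans_lt hx.1, hx.2.le⟩
  have hPa : 0 ≤ P2fun n p u u' a := by
    have := hterm a (hlt a le_rfl har).le
    rw [P2fun, hua]
    have : 0 ≤ a ^ n * (0 ^ 2 + ((n : ℝ) - 2) / n * (u a * f p (u a))) := by positivity
    linarith
  have hmono : StrictMonoOn (P2fun n p u u') (Icc a r) := by
    refine strictMonoOn_of_hasDerivWithinAt_pos (convex_Icc a r)
      ((hu.continuousOn_P2fun hp).mono fun x hx => ha0.trans hx.1)
      (fun x hx => (hu.hasDerivAt_P2fun hn hp ?_).hasDerivWithinAt) ?_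
    · rw [interior_Icc] at hx
      exact ha0.trans_lt hx.1
    · intro x hx
      rw [interior_Icc] at hx
      have hx0 : 0 < x := ha0.trans_lt hx.1
      have h1 := (hge x (hlt x hx.1.le hx.2).le).2
      have h2 : 0 < pohozaevCoeff n p * (p + 1) * |u x| ^ (p - 1) - 4 := by nlinarith
      have h3 := harc x ⟨hx.1, hx.2.le⟩
      have := mul_pos (mul_pos (by positivity : 0 < x ^ n / n) h2) (neg_pos.2 h3)
      linarith
  exact hPa.trans_lt (hmono (left_mem_Icc.2 har.le) (right_mem_Icc.2 har.le) har)

end IsSolution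

/-- positivity of `E`, `P`, `P₁`, `P₂` — on all of `(0,∞)` if `u` is decaying,
and on `(0, z_k]` otherwise. -/
theorem statement13 (n : ℕ) (hn : 3 ≤ n) (p : ℝ) (hp1 : 1 < p)
    (hp2 : p < ((n : ℝ) + 2) / ((n : ℝ) - 2))
    (α : ℝ) (hα : 0 < α)
    (u u' u'' : ℝ → ℝ) (hu : IsSolution n p α u u' u'')
    (k : ℕ) (hk : 0 < k) (z : Fin k → ℝ)
    (hcase : (Decaying u u' ∧ ∀ r : ℝ, 0 ≤ r → 0 < u r) ∨
             (ChangesSign u ∧ ExactZeros u k z)) :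
    ∀ r : ℝ, 0 < r → (Decaying u u' ∨ r ≤ z ⟨k - 1, by omega⟩) →
      0 < Efun p u u' r ∧ 0 < Pfun n p u u' r ∧
      0 < P1fun n p u u' r ∧ 0 < P2fun n p u u' r := by
  have hE : ∀ s, 0 < s → (Decaying u u' ∨ ∃ z, s ≤ z ∧ u z = 0) → 0 < Efun p u u' s := by
    rintro s hs (hd | ⟨z, hz, hz'⟩)
    · exact hu.Efun_pos_of_decaying hn hp1 hα hd hs
    · exact hu.Efun_pos_of_le_zero hn hp1 hα hs hz hz'
  intro r hr hend
  have hend' : Decaying u u' ∨ ∃ z, r ≤ z ∧ u z = 0 := by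
    rcases hcase with ⟨hd, -⟩ | ⟨-, -, hzero, -⟩
    · exact Or.inl hd
    · exact hend.imp_right fun h => ⟨_, h, (hzero _).2⟩
  have hP := hu.Pfun_pos hn hp1 hp2 hr hend' hE
  exact ⟨hE r hr hend', hP, IsSolution.P1fun_pos hp1 hr hP, hu.P2fun_pos hn hp1 hp2 hr hP⟩
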